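/- Let κ and ω^{AB} be the Dirac current and 3-forms associated to s ∈ S. Then (i) ι_κ ω^{AB} = 0, and (ii) κ♭ ∧ ω^{AB} = 0, for all A,B. -/

import Mathlib

/-!
Algebraic set-up for six-dimensional (1,0) spinor calculus.

`(V, η)` is the six-dimensional mostly-plus lorentzian vector space, realised as
`Fin 6 → ℝ` with metric `ηd = diag(-1,1,1,1,1,1)`.  The (complexified) Clifford
module `Σ` is realised as `Spinor8 = Fin 8 → ℂ`; the structure `CliffordData`
packages gamma matrices satisfying the Clifford relation `v·v = η(v,v)𝟙`, the
symmetric spinor inner product `⟨-,-⟩` (given by the matrix `B`, symmetric,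
nondegenerate, with `⟨v·s,t⟩ = -⟨s,v·t⟩`, and for which the chiral summands are
isotropic), and the quaternionic structure `J`.  `Δ` is the fundamental `Sp(1)`
module `Fin 2 → ℂ` with symplectic form `epsS` (`ε₁₂ = 1`), and an element of
the real representation `S` with `S ⊗ ℂ = Σ₊ ⊗ Δ` is a pair `s : Fin 2 → Spinor8`
of positive-chirality spinors satisfying the reality condition `IsS`.
-/

noncomputable section

open Matrix BigOperators

/-- Spinors of the 8-dimensional complex Clifford module Σ. -/
abbrev Spinor8 := Fin 8 → ℂ

/-- Mostly-plus Minkowski metric `diag(-1,1,1,1,1,1)`. -/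
def ηd (μ : Fin 6) : ℝ := if μ = 0 then -1 else 1

/-- The symplectic form ε on Δ, with `ε₁₂ = 1`. -/
def epsS (A B : Fin 2) : ℂ := if A = 0 ∧ B = 1 then 1 else if A = 1 ∧ B = 0 then -1 else 0

/-- The Levi-Civita symbol on six indices. -/
def eps6 (μ ν ρ σ τ υ : Fin 6) : ℝ :=
  (Matrix.of (fun i j => if (![μ, ν, ρ, σ, τ, υ] i) = j then (1 : ℝ) else 0) :
    Matrix (Fin 6) (Fin 6) ℝ).det

/-- Data of the irreducible Clifford module Σ of `Cℓ(V)`, `V = ℝ^{5,1}`: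
gamma matrices, the symmetric spinor pairing `B` and the quaternionic
structure `J`. -/
structure CliffordData where
  /-- gamma matrices `Γ_μ` -/
  Γ : Fin 6 → Matrix (Fin 8) (Fin 8) ℂ
  /-- the Clifford relation `Γ_μ Γ_ν + Γ_ν Γ_μ = 2 η_{μν} 𝟙` -/
  clifford : ∀ μ ν, Γ μ * Γ ν + Γ ν * Γ μ =
    (if μ = ν then 2 * (ηd μ : ℂ) else 0) • (1 : Matrix (Fin 8) (Fin 8) ℂ)
  /-- matrix of the symmetric inner product `⟨-,-⟩`, `⟨s,t⟩ = sᵀ B t` -/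
  B : Matrix (Fin 8) (Fin 8) ℂ
  B_symm : B.transpose = B
  B_nondeg : IsUnit B
  /-- `⟨v·s, t⟩ = -⟨s, v·t⟩` -/
  B_skew : ∀ μ, (Γ μ).transpose * B = - (B * Γ μ)
  /-- the chiral summands `Σ±` are isotropic for `⟨-,-⟩`:
      `⟨P₊s, P₊t⟩ = 0 = ⟨P₋s, P₋t⟩`, where `P± = ½(1 ± Γ₇)` -/
  B_iso_pos : ((1 : Matrix (Fin 8) (Fin 8) ℂ) + Γ 0 * Γ 1 * Γ 2 * Γ 3 * Γ 4 * Γ 5).transpose *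
      B * (1 + Γ 0 * Γ 1 * Γ 2 * Γ 3 * Γ 4 * Γ 5) = 0
  B_iso_neg : ((1 : Matrix (Fin 8) (Fin 8) ℂ) - Γ 0 * Γ 1 * Γ 2 * Γ 3 * Γ 4 * Γ 5).transpose *
      B * (1 - Γ 0 * Γ 1 * Γ 2 * Γ 3 * Γ 4 * Γ 5) = 0
  /-- quaternionic structure on Σ: the conjugate-linear map `s ↦ J (star s)` -/
  J : Matrix (Fin 8) (Fin 8) ℂ
  J_conj : ∀ μ, J * (Γ μ).map (starRingEnd ℂ) = Γ μ * J
  J_sq : J * J.map (starRingEnd ℂ) = -1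

namespace CliffordData

variable (d : CliffordData)

/-- the Clifford volume element `Γ₇ = Γ₀Γ₁Γ₂Γ₃Γ₄Γ₅` -/
def Γ7 : Matrix (Fin 8) (Fin 8) ℂ := d.Γ 0 * d.Γ 1 * d.Γ 2 * d.Γ 3 * d.Γ 4 * d.Γ 5

/-- gamma matrix with raised index, `Γ^μ = η^{μμ} Γ_μ` -/
def ΓU (μ : Fin 6) : Matrix (Fin 8) (Fin 8) ℂ := (ηd μ : ℂ) • d.Γ μ

/-- the pairing `s̄ t = ⟨s, t⟩` -/
def pair (s t : Spinor8) : ℂ := s ⬝ᵥ d.B.mulVec t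

/-- positive chirality: `Γ₇ s = s`, i.e. `s ∈ Σ₊` -/
def Pos (s : Spinor8) : Prop := d.Γ7.mulVec s = s

/-- the quaternionic conjugation on Σ -/
def conjS (s : Spinor8) : Spinor8 := d.J.mulVec fun a => (starRingEnd ℂ) (s a)

/-- membership in (the complexification of) the real form `S ⊂ Σ₊ ⊗ Δ`:
positive chirality together with the reality condition w.r.t. the
quaternionic structure `J ⊗ J_Δ` (`J_Δ` the standard one on `Δ`). -/
def IsS (s : Fin 2 → Spinor8) : Prop :=
  (∀ A, d.Pos (s A)) ∧ d.conjS (s 0) = s 1 ∧ d.conjS (s 1) = - s 0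

/-- antisymmetrised product `Γ_{μν}` -/
def Γ2 (μ ν : Fin 6) : Matrix (Fin 8) (Fin 8) ℂ :=
  (1 / 2 : ℂ) • (d.Γ μ * d.Γ ν - d.Γ ν * d.Γ μ)

/-- antisymmetrised product `Γ_{μνρ}` -/
def Γ3 (μ ν ρ : Fin 6) : Matrix (Fin 8) (Fin 8) ℂ :=
  (1 / 6 : ℂ) • (d.Γ μ * d.Γ ν * d.Γ ρ - d.Γ μ * d.Γ ρ * d.Γ ν
    + d.Γ ν * d.Γ ρ * d.Γ μ - d.Γ ν * d.Γ μ * d.Γ ρ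
    + d.Γ ρ * d.Γ μ * d.Γ ν - d.Γ ρ * d.Γ ν * d.Γ μ)

/-- the family of 3-forms `ω_{μνρ}{}^{AB} = s̄^A Γ_{μνρ} s^B` -/
def omega3 (s : Fin 2 → Spinor8) (A B : Fin 2) (μ ν ρ : Fin 6) : ℂ :=
  d.pair (s A) ((d.Γ3 μ ν ρ).mulVec (s B))

/-- the Dirac current `κ^μ = ε_{AB} s̄^A Γ^μ s^B` -/
def kappa (s : Fin 2 → Spinor8) (μ : Fin 6) : ℂ :=
  ∑ A, ∑ B, epsS A B * d.pair (s A) ((d.ΓU μ).mulVec (s B))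

end CliffordData

/-- Hodge star on 3-forms (components, indices down):
`(⋆T)_{μνρ} = (1/3!) ε_{μνρ}{}^{στυ} T_{στυ}`. -/
def hodge3C (T : Fin 6 → Fin 6 → Fin 6 → ℂ) (μ ν ρ : Fin 6) : ℂ :=
  (1 / 6 : ℂ) * ∑ σ, ∑ τ, ∑ υ,
    (eps6 μ ν ρ σ τ υ : ℂ) * (ηd σ : ℂ) * (ηd τ : ℂ) * (ηd υ : ℂ) * T σ τ υ

/-- (components of) an alternating 3-tensor -/
def Alt3 (T : Fin 6 → Fin 6 → Fin 6 → ℂ) : Prop :=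
  ∀ μ ν ρ, T ν μ ρ = - T μ ν ρ ∧ T μ ρ ν = - T μ ν ρ

/-- self-dual 3-form, `⋆T = T` -/
def SelfDual3 (T : Fin 6 → Fin 6 → Fin 6 → ℂ) : Prop :=
  ∀ μ ν ρ, hodge3C T μ ν ρ = T μ ν ρ

/-- antiself-dual 3-form, `⋆T = -T` -/
def AntiSelfDual3 (T : Fin 6 → Fin 6 → Fin 6 → ℂ) : Prop :=
  ∀ μ ν ρ, hodge3C T μ ν ρ = - T μ ν ρ

namespace CliffordData

variable (d : CliffordData)

theorem Γ_mul_self (μ : Fin 6) : d.Γ μ * d.Γ μ = (ηd μ : ℂ) • 1 := by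
  have h := d.clifford μ μ
  rw [if_pos rfl, ← two_smul ℂ, mul_smul] at h
  exact smul_right_injective _ two_ne_zero h

theorem Γ_mul_Γ_of_ne {μ ν : Fin 6} (h : μ ≠ ν) : d.Γ μ * d.Γ ν = -(d.Γ ν * d.Γ μ) := by
  have h' := d.clifford μ ν
  rw [if_neg h, zero_smul] at h'
  exact eq_neg_of_add_eq_zero_left h'

theorem Γ_mul_prod (μ : Fin 6) (l : List (Fin 6)) :
    d.Γ μ * (l.map d.Γ).prod =
      (-1 : ℂ) ^ l.countP (fun ν => decide (ν ≠ μ)) • ((l.map d.Γ).prod * d.Γ μ) := by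
  induction l with
  | nil => simp
  | cons ν l ih =>
    rw [List.map_cons, List.prod_cons, List.countP_cons]
    by_cases h : ν = μ
    · subst h
      simp only [ne_eq, not_true_eq_false, decide_false, Bool.false_eq_true, if_false, add_zero]
      rw [mul_assoc, ← mul_smul_comm, ← ih]
    · rw [← mul_assoc, d.Γ_mul_Γ_of_ne (Ne.symm h), neg_mul, mul_assoc, ih]
      simp [h, pow_succ, mul_assoc]

theorem exists_sign_prod_of_perm {l l' : List (Fin 6)} (h : l.Perm l') (hl : l.Nodup) :
    ∃ k : ℂ, k * k = 1 ∧ (l.map d.Γ).prod = k • (l'.map d.Γ).prod := by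
  induction h with
  | nil => exact ⟨1, by simp⟩
  | cons a _ ih =>
    obtain ⟨k, hk, e⟩ := ih hl.of_cons
    exact ⟨k, hk, by simp [e]⟩
  | swap a b l =>
    have hab : b ≠ a := by
      rintro rfl
      simp at hl
    refine ⟨-1, by norm_num, ?_⟩
    simp only [List.map_cons, List.prod_cons, ← mul_assoc]
    rw [d.Γ_mul_Γ_of_ne hab]
    simp
  | trans h₁ _ ih₁ ih₂ =>
    obtain ⟨k, hk, e⟩ := ih₁ hl
    obtain ⟨k', hk', e'⟩ := ih₂ (h₁.nodup_iff.mp hl)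
    exact ⟨k * k', by linear_combination k' * k' * hk + hk', by rw [e, e', smul_smul]⟩

theorem Γ_triple_sq {a b c : Fin 6} (hab : a ≠ b) (hac : a ≠ c) (hbc : b ≠ c) :
    d.Γ a * d.Γ b * d.Γ c * (d.Γ a * d.Γ b * d.Γ c) =
      (-((ηd a : ℂ) * ηd b * ηd c)) • (1 : Matrix (Fin 8) (Fin 8) ℂ) := by
  have h := d.Γ_mul_prod a [b, c]
  simp [hab.symm, hac.symm] at h
  calc d.Γ a * d.Γ b * d.Γ c * (d.Γ a * d.Γ b * d.Γ c)
      = d.Γ a * (d.Γ b * d.Γ c * d.Γ a) * d.Γ b * d.Γ c := by simp only [mul_assoc]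
    _ = (d.Γ a * d.Γ a) * d.Γ b * (d.Γ c * d.Γ b) * d.Γ c := by
        rw [← h]; simp only [mul_assoc]
    _ = -((d.Γ a * d.Γ a) * (d.Γ b * d.Γ b) * (d.Γ c * d.Γ c)) := by
        rw [d.Γ_mul_Γ_of_ne hbc.symm]; simp only [mul_assoc, mul_neg, neg_mul]
    _ = _ := by
        simp only [Γ_mul_self, smul_mul_smul_comm, mul_one, neg_smul]

theorem Γ7_eq_prod : d.Γ7 = (([0, 1, 2, 3, 4, 5] : List (Fin 6)).map d.Γ).prod := by
  simp [Γ7, mul_assoc]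

theorem Γ_mul_Γ7 (μ : Fin 6) : d.Γ μ * d.Γ7 = -(d.Γ7 * d.Γ μ) := by
  have h : ∀ μ : Fin 6, List.countP (fun ν => decide (ν ≠ μ)) [0, 1, 2, 3, 4, 5] = 5 := by decide
  rw [Γ7_eq_prod, Γ_mul_prod, h]
  norm_num

theorem Γ7_mul_self : d.Γ7 * d.Γ7 = 1 := by
  have h₁ := d.Γ_triple_sq (a := 0) (b := 1) (c := 2) (by decide) (by decide) (by decide)
  have h₂ := d.Γ_triple_sq (a := 3) (b := 4) (c := 5) (by decide) (by decide) (by decide)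
  calc d.Γ7 * d.Γ7
      = d.Γ 0 * d.Γ 1 * d.Γ 2 * d.Γ 3 * d.Γ 4 * (d.Γ 5 * d.Γ7) := by
        rw [← mul_assoc]; rfl
    _ = -(d.Γ 0 * d.Γ 1 * d.Γ 2 * d.Γ7 * (d.Γ 3 * d.Γ 4 * d.Γ 5)) := by
        rw [Γ_mul_Γ7, mul_neg, ← mul_assoc, mul_assoc _ (d.Γ 4) d.Γ7, Γ_mul_Γ7, mul_neg,
          ← mul_assoc, mul_assoc _ (d.Γ 3) d.Γ7, Γ_mul_Γ7]
        simp only [mul_neg, neg_mul, neg_neg, mul_assoc]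
    _ = -((d.Γ 0 * d.Γ 1 * d.Γ 2 * (d.Γ 0 * d.Γ 1 * d.Γ 2)) *
          (d.Γ 3 * d.Γ 4 * d.Γ 5 * (d.Γ 3 * d.Γ 4 * d.Γ 5))) := by
        simp only [Γ7, mul_assoc]
    _ = 1 := by
        rw [h₁, h₂]
        simp [ηd]

theorem pair_Γ_mulVec (μ : Fin 6) (a b : Spinor8) :
    d.pair a ((d.Γ μ).mulVec b) = -d.pair ((d.Γ μ).mulVec a) b := by
  rw [pair, pair, mulVec_mulVec, ← neg_neg (d.B * d.Γ μ), ← d.B_skew, neg_mulVec, dotProduct_neg,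
    ← mulVec_mulVec, dotProduct_mulVec, vecMul_transpose]

theorem pair_comm (a b : Spinor8) : d.pair a b = d.pair b a := by
  rw [pair, dotProduct_mulVec, ← mulVec_transpose, d.B_symm, dotProduct_comm, pair]

theorem pair_Γ_mulVec_swap (μ : Fin 6) (a b : Spinor8) :
    d.pair a ((d.Γ μ).mulVec b) = -d.pair b ((d.Γ μ).mulVec a) := by
  rw [pair_Γ_mulVec, pair_comm]

/-- The linear functional `⟨s, -⟩`. -/
def bar (s : Spinor8) : Spinor8 →ₗ[ℂ] ℂ where
  toFun := d.pair s
  map_add' x y := by simp [pair, mulVec_add]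
  map_smul' c x := by simp [pair, mulVec_smul]

theorem bar_apply (s t : Spinor8) : d.bar s t = d.pair s t := rfl

theorem bar_ne_zero {s : Spinor8} (hs : s ≠ 0) : d.bar s ≠ 0 := by
  intro h
  apply hs
  apply vecMul_injective_of_isUnit d.B_nondeg
  change s ᵥ* d.B = 0 ᵥ* d.B
  rw [zero_vecMul]
  refine dotProduct_eq_zero _ fun t => ?_
  rw [← dotProduct_mulVec]
  exact LinearMap.congr_fun h t

/-- Clifford multiplication by a complexified vector with components `v^μ`. -/
def slash : (Fin 6 → ℂ) →ₗ[ℂ] Matrix (Fin 8) (Fin 8) ℂ := Fintype.linearCombination ℂ d.Γ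

theorem slash_apply (v : Fin 6 → ℂ) : d.slash v = ∑ μ, v μ • d.Γ μ := rfl

theorem slash_mul_self (v : Fin 6 → ℂ) :
    d.slash v * d.slash v = (∑ μ, (ηd μ : ℂ) * v μ * v μ) • 1 := by
  have h : d.slash v * d.slash v + d.slash v * d.slash v =
      ∑ μ, ∑ ν, (v μ * v ν) • (d.Γ μ * d.Γ ν + d.Γ ν * d.Γ μ) := by
    simp only [smul_add, Finset.sum_add_distrib]
    congr 1
    · simp only [slash_apply, Finset.sum_mul_sum, smul_mul_smul_comm]
    · rw [Finset.sum_comm]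
      simp only [slash_apply, Finset.sum_mul_sum, smul_mul_smul_comm, mul_comm]
  simp only [d.clifford, ite_smul, zero_smul, smul_ite, smul_zero, Finset.sum_ite_eq,
    Finset.mem_univ, if_true, smul_smul, ← Finset.sum_smul] at h
  rw [← two_smul ℂ] at h
  apply smul_right_injective _ (two_ne_zero (α := ℂ))
  simp only [h, smul_smul, Finset.mul_sum]
  congr 1
  exact Finset.sum_congr rfl fun μ _ => by ring

theorem slash_mulVec (v : Fin 6 → ℂ) (s : Spinor8) :
    (d.slash v).mulVec s = ∑ μ, v μ • (d.Γ μ).mulVec s := by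
  simp only [slash_apply, sum_mulVec, smul_mulVec]

theorem pair_slash_mulVec (v : Fin 6 → ℂ) (a b : Spinor8) :
    d.pair a ((d.slash v).mulVec b) = ∑ μ, v μ * d.pair a ((d.Γ μ).mulVec b) := by
  simp only [slash_mulVec, ← bar_apply, map_sum, map_smul, smul_eq_mul]

theorem pair_slash_mulVec_swap (v : Fin 6 → ℂ) (a b : Spinor8) :
    d.pair a ((d.slash v).mulVec b) = -d.pair b ((d.slash v).mulVec a) := by
  simp only [pair_slash_mulVec, d.pair_Γ_mulVec_swap _ a b, mul_neg, Finset.sum_neg_distrib]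

theorem pair_slash_mulVec_eq_zero {v : Fin 6 → ℂ} {a : Spinor8}
    (h : (d.slash v).mulVec a = 0) (b : Spinor8) : d.pair a ((d.slash v).mulVec b) = 0 := by
  rw [pair_slash_mulVec_swap, h, ← bar_apply, map_zero, neg_zero]

/-- The negative chirality summand `Σ₋`. -/
def negChirality : Submodule ℂ Spinor8 := LinearMap.ker (d.Γ7 + 1).mulVecLin

theorem mem_negChirality {t : Spinor8} : t ∈ d.negChirality ↔ d.Γ7.mulVec t = -t := by
  rw [negChirality, LinearMap.mem_ker, mulVecLin_apply, add_mulVec, one_mulVec,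
    add_eq_zero_iff_eq_neg]

theorem Γ7_mulVec_Γ (μ : Fin 6) (t : Spinor8) :
    d.Γ7.mulVec ((d.Γ μ).mulVec t) = -(d.Γ μ).mulVec (d.Γ7.mulVec t) := by
  rw [mulVec_mulVec, mulVec_mulVec, Γ_mul_Γ7, neg_mulVec, neg_neg]

theorem slash_mulVec_mem_negChirality {s : Spinor8} (hs : d.Pos s) (v : Fin 6 → ℂ) :
    (d.slash v).mulVec s ∈ d.negChirality := by
  rw [slash_mulVec]
  refine Submodule.sum_mem _ fun μ _ => Submodule.smul_mem _ _ ?_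
  rw [mem_negChirality, Γ7_mulVec_Γ, hs]

theorem finrank_negChirality_le : Module.finrank ℂ d.negChirality ≤ 4 := by
  have hinj : Function.Injective (d.Γ 1).mulVecLin := by
    intro x y h
    have h' := congrArg (d.Γ 1).mulVec h
    simpa [Γ_mul_self, ηd] using h'
  have hdisj : Disjoint d.negChirality (d.negChirality.map (d.Γ 1).mulVecLin) := by
    rw [Submodule.disjoint_def]
    rintro _ hx ⟨y, hy, rfl⟩
    rw [mulVecLin_apply] at hx ⊢
    rw [SetLike.mem_coe, mem_negChirality] at hy
    rw [mem_negChirality, Γ7_mulVec_Γ, hy, mulVec_neg, neg_neg] at hx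
    exact self_eq_neg.mp hx
  have hmap : Module.finrank ℂ d.negChirality =
      Module.finrank ℂ (d.negChirality.map (d.Γ 1).mulVecLin) :=
    (Submodule.equivMapOfInjective _ hinj d.negChirality).finrank_eq
  have h : Module.finrank ℂ d.negChirality +
      Module.finrank ℂ (d.negChirality.map (d.Γ 1).mulVecLin) ≤ 8 :=
    (Submodule.finrank_add_finrank_le_of_disjoint hdisj).trans_eq (Module.finrank_fin_fun ℂ)
  omega

/-- `Σ₊` is isotropic, so a nonzero positive spinor pairs nontrivially with `Σ₋`. -/
theorem exists_negChirality_pair_ne_zero {s : Spinor8} (hs : d.Pos s) (h0 : s ≠ 0) :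
    ∃ t ∈ d.negChirality, d.pair s t ≠ 0 := by
  obtain ⟨t, ht⟩ := DFunLike.ne_iff.mp (d.bar_ne_zero h0)
  have hiso : d.pair s ((1 + d.Γ7).mulVec t) = 0 := by
    have h := congrArg (fun M => s ⬝ᵥ M.mulVec t) d.B_iso_pos
    change s ⬝ᵥ ((1 + d.Γ7).transpose * d.B * (1 + d.Γ7)).mulVec t = _ at h
    rw [mul_assoc, ← mulVec_mulVec, dotProduct_mulVec, vecMul_transpose, add_mulVec, one_mulVec,
      hs, ← mulVec_mulVec] at h
    change d.pair (s + s) _ = _ at h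
    rw [pair_comm, ← bar_apply, map_add, bar_apply, pair_comm] at h
    simpa using h
  refine ⟨(1 - d.Γ7).mulVec t, ?_, ?_⟩
  · rw [mem_negChirality, mulVec_mulVec, mul_sub, Γ7_mul_self, mul_one, ← neg_mulVec, neg_sub]
  · intro h
    apply ht
    rw [sub_mulVec, one_mulVec, ← bar_apply, map_sub] at h
    rw [add_mulVec, one_mulVec, ← bar_apply, map_add] at hiso
    rw [LinearMap.zero_apply]
    linear_combination (h + hiso) / 2

/-- The complexified metric. -/
def metric : LinearMap.BilinForm ℂ (Fin 6 → ℂ) :=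
  Matrix.toBilin' (Matrix.diagonal fun μ => (ηd μ : ℂ))

theorem metric_apply (v w : Fin 6 → ℂ) : metric v w = ∑ μ, (ηd μ : ℂ) * v μ * w μ := by
  simp only [metric, toBilin'_apply', mulVec_diagonal, dotProduct]
  exact Finset.sum_congr rfl fun μ _ => by ring

theorem ηd_mul_self (μ : Fin 6) : (ηd μ : ℂ) * ηd μ = 1 := by
  unfold ηd
  split_ifs <;> norm_num

theorem metric_nondegenerate : metric.Nondegenerate := by
  refine LinearMap.BilinForm.nondegenerate_toBilin'_of_det_ne_zero' _ ?_
  rw [det_diagonal, Finset.prod_ne_zero_iff]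
  intro μ _ h
  simpa [h] using ηd_mul_self μ

/-- The complexified vectors annihilating a spinor. -/
def annihilator (s : Spinor8) : Submodule ℂ (Fin 6 → ℂ) :=
  LinearMap.ker ((mulVecBilin ℂ ℂ).flip s ∘ₗ d.slash)

theorem mem_annihilator {s : Spinor8} {v : Fin 6 → ℂ} :
    v ∈ d.annihilator s ↔ (d.slash v).mulVec s = 0 := Iff.rfl

theorem metric_self_eq_zero {s : Spinor8} (h0 : s ≠ 0) {v : Fin 6 → ℂ}
    (hv : v ∈ d.annihilator s) : metric v v = 0 := by
  have h := congrArg (d.slash v).mulVec (d.mem_annihilator.mp hv)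
  rw [mulVec_mulVec, slash_mul_self, ← metric_apply, smul_mulVec, one_mulVec, mulVec_zero] at h
  exact (smul_eq_zero.mp h).resolve_right h0

theorem metric_comm (v w : Fin 6 → ℂ) : metric v w = metric w v := by
  simp only [metric_apply, mul_right_comm]

theorem annihilator_le_orthogonal {s : Spinor8} (h0 : s ≠ 0) :
    d.annihilator s ≤ metric.orthogonal (d.annihilator s) := by
  intro v hv w hw
  have h := d.metric_self_eq_zero h0 (add_mem hv hw)
  simp only [map_add, LinearMap.add_apply, d.metric_self_eq_zero h0 hv,
    d.metric_self_eq_zero h0 hw, metric_comm v w] at h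
  change metric w v = 0
  linear_combination h / 2

theorem three_le_finrank_annihilator {s : Spinor8} (hs : d.Pos s) (h0 : s ≠ 0) :
    3 ≤ Module.finrank ℂ (d.annihilator s) := by
  obtain ⟨t, ht, hst⟩ := d.exists_negChirality_pair_ne_zero hs h0
  have hlt : LinearMap.range ((mulVecBilin ℂ ℂ).flip s ∘ₗ d.slash) < d.negChirality := by
    refine lt_of_le_of_ne ?_ ?_
    · rintro _ ⟨v, rfl⟩
      exact d.slash_mulVec_mem_negChirality hs v
    · intro h
      rw [← h] at ht
      obtain ⟨v, rfl⟩ := ht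
      exact hst (self_eq_neg.mp (d.pair_slash_mulVec_swap v s s))
  have h₁ : Module.finrank ℂ (LinearMap.range ((mulVecBilin ℂ ℂ).flip s ∘ₗ d.slash)) <
      Module.finrank ℂ d.negChirality := Submodule.finrank_lt_finrank_of_lt hlt
  have h₂ := d.finrank_negChirality_le
  have h₃ : Module.finrank ℂ (LinearMap.range ((mulVecBilin ℂ ℂ).flip s ∘ₗ d.slash)) +
      Module.finrank ℂ (d.annihilator s) = 6 :=
    (LinearMap.finrank_range_add_finrank_ker _).trans (Module.finrank_fin_fun ℂ)
  omega

/-- Positive spinors are pure: the annihilator is maximally isotropic. -/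
theorem orthogonal_annihilator {s : Spinor8} (hs : d.Pos s) (h0 : s ≠ 0) :
    metric.orthogonal (d.annihilator s) = d.annihilator s := by
  symm
  apply Submodule.eq_of_le_of_finrank_le (d.annihilator_le_orthogonal h0)
  rw [LinearMap.BilinForm.finrank_orthogonal metric_nondegenerate, Module.finrank_fin_fun]
  have := d.three_le_finrank_annihilator hs h0
  omega

/-- The six-dimensional Fierz identity `⟨a, Γ^μ b⟩ Γ_μ b = 0`. -/
theorem slash_current_mulVec (a : Spinor8) {b : Spinor8} (hb : d.Pos b) :
    (d.slash fun μ => d.pair a ((d.ΓU μ).mulVec b)).mulVec b = 0 := by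
  by_cases h0 : b = 0
  · rw [h0, mulVec_zero]
  rw [← mem_annihilator, ← d.orthogonal_annihilator hb h0]
  intro v hv
  change metric v _ = 0
  rw [metric_apply]
  have h := d.pair_slash_mulVec v a b
  rw [d.mem_annihilator.mp hv, ← bar_apply, map_zero] at h
  rw [h]
  refine Finset.sum_congr rfl fun μ _ => ?_
  rw [ΓU, smul_mulVec, ← bar_apply, map_smul, smul_eq_mul, bar_apply]
  linear_combination v μ * d.pair a ((d.Γ μ).mulVec b) * ηd_mul_self μ

theorem pair_ΓU_mulVec_swap (μ : Fin 6) (a b : Spinor8) :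
    d.pair a ((d.ΓU μ).mulVec b) = -d.pair b ((d.ΓU μ).mulVec a) := by
  simp only [ΓU, smul_mulVec, ← bar_apply, map_smul]
  simp only [bar_apply, d.pair_Γ_mulVec_swap μ a b, smul_neg]

theorem kappa_eq (s : Fin 2 → Spinor8) (μ : Fin 6) :
    d.kappa s μ = 2 * d.pair (s 0) ((d.ΓU μ).mulVec (s 1)) := by
  simp only [kappa, Fin.sum_univ_two, epsS]
  norm_num
  rw [d.pair_ΓU_mulVec_swap μ (s 1) (s 0)]
  ring

/-- The Dirac current annihilates the spinors it is built from. -/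
theorem slash_kappa_mulVec {s : Fin 2 → Spinor8} (hs : ∀ A, d.Pos (s A)) (A : Fin 2) :
    (d.slash (d.kappa s)).mulVec (s A) = 0 := by
  match A with
  | 0 =>
    have h : d.kappa s = (-2 : ℂ) • fun μ => d.pair (s 1) ((d.ΓU μ).mulVec (s 0)) := by
      funext μ
      rw [kappa_eq, pair_ΓU_mulVec_swap, Pi.smul_apply, smul_eq_mul]
      ring
    rw [h, map_smul, smul_mulVec, slash_current_mulVec _ _ (hs 0), smul_zero]
  | 1 =>
    have h : d.kappa s = (2 : ℂ) • fun μ => d.pair (s 0) ((d.ΓU μ).mulVec (s 1)) := by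
      funext μ
      rw [kappa_eq, Pi.smul_apply, smul_eq_mul]
    rw [h, map_smul, smul_mulVec, slash_current_mulVec _ _ (hs 1), smul_zero]

theorem Γ3_eq_symm_Γ2 (μ ν ρ : Fin 6) :
    d.Γ3 μ ν ρ = (1 / 2 : ℂ) • (d.Γ μ * d.Γ2 ν ρ + d.Γ2 ν ρ * d.Γ μ) := by
  have h₁ := congrArg (· * d.Γ ρ) (d.clifford μ ν)
  have h₂ := congrArg (d.Γ ν * ·) (d.clifford μ ρ)
  have h₃ := congrArg (· * d.Γ ν) (d.clifford μ ρ)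
  have h₄ := congrArg (d.Γ ρ * ·) (d.clifford μ ν)
  simp only [add_mul, mul_add, smul_mul_assoc, mul_smul_comm, one_mul, mul_one,
    ← mul_assoc] at h₁ h₂ h₃ h₄
  simp only [Γ3, Γ2, smul_mul_assoc, mul_smul_comm, mul_sub, sub_mul, ← mul_assoc]
  linear_combination (norm := module)
    (-1 / 12 : ℂ) • h₁ + (-1 / 12 : ℂ) • h₂ + (1 / 12 : ℂ) • h₃ + (1 / 12 : ℂ) • h₄

/-- `ι_κ ω = 0`. -/
theorem sum_kappa_mul_omega3 {s : Fin 2 → Spinor8} (hs : ∀ A, d.Pos (s A)) (A B : Fin 2)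
    (ν ρ : Fin 6) : ∑ μ, d.kappa s μ * d.omega3 s A B μ ν ρ = 0 := by
  have hsum : ∑ μ, d.kappa s μ • d.Γ3 μ ν ρ =
      (1 / 2 : ℂ) • (d.slash (d.kappa s) * d.Γ2 ν ρ + d.Γ2 ν ρ * d.slash (d.kappa s)) := by
    simp only [Γ3_eq_symm_Γ2, slash_apply, Finset.sum_mul, Finset.mul_sum, smul_mul_assoc,
      mul_smul_comm, ← Finset.sum_add_distrib, Finset.smul_sum, smul_add]
    refine Finset.sum_congr rfl fun μ _ => ?_
    module
  calc ∑ μ, d.kappa s μ * d.omega3 s A B μ ν ρ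
      = d.pair (s A) ((∑ μ, d.kappa s μ • d.Γ3 μ ν ρ).mulVec (s B)) := by
        simp only [sum_mulVec, smul_mulVec, ← bar_apply, map_sum, map_smul, smul_eq_mul, omega3]
    _ = 0 := by
        rw [hsum, smul_mulVec, add_mulVec, ← mulVec_mulVec, ← mulVec_mulVec,
          d.slash_kappa_mulVec hs B, mulVec_zero, add_zero, ← bar_apply, map_smul, bar_apply,
          d.pair_slash_mulVec_eq_zero (d.slash_kappa_mulVec hs A), smul_zero]

theorem omega3_swap_left (s : Fin 2 → Spinor8) (A B : Fin 2) (μ ν ρ : Fin 6) :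
    d.omega3 s A B ν μ ρ = -d.omega3 s A B μ ν ρ := by
  have h : d.Γ3 ν μ ρ = -d.Γ3 μ ν ρ := by
    simp only [Γ3]
    module
  rw [omega3, h, neg_mulVec, ← bar_apply, map_neg]
  rfl

theorem omega3_swap_right (s : Fin 2 → Spinor8) (A B : Fin 2) (μ ν ρ : Fin 6) :
    d.omega3 s A B μ ρ ν = -d.omega3 s A B μ ν ρ := by
  have h : d.Γ3 μ ρ ν = -d.Γ3 μ ν ρ := by
    simp only [Γ3]
    module
  rw [omega3, h, neg_mulVec, ← bar_apply, map_neg]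
  rfl

theorem omega3_self_left (s : Fin 2 → Spinor8) (A B : Fin 2) (μ ρ : Fin 6) :
    d.omega3 s A B μ μ ρ = 0 := self_eq_neg.mp (d.omega3_swap_left s A B μ μ ρ)

theorem omega3_self_right (s : Fin 2 → Spinor8) (A B : Fin 2) (μ ρ : Fin 6) :
    d.omega3 s A B μ ρ ρ = 0 := self_eq_neg.mp (d.omega3_swap_right s A B μ ρ ρ)

theorem omega3_self_outer (s : Fin 2 → Spinor8) (A B : Fin 2) (μ ρ : Fin 6) :
    d.omega3 s A B μ ρ μ = 0 := by
  rw [omega3_swap_right, omega3_self_left, neg_zero]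

theorem Γ3_of_ne {a b c : Fin 6} (hab : a ≠ b) (hac : a ≠ c) (hbc : b ≠ c) :
    d.Γ3 a b c = d.Γ a * d.Γ b * d.Γ c := by
  have h₁ : d.Γ a * d.Γ c * d.Γ b = -(d.Γ a * d.Γ b * d.Γ c) := by
    rw [mul_assoc, d.Γ_mul_Γ_of_ne hbc.symm, mul_neg, mul_assoc]
  have h₂ : d.Γ b * d.Γ a * d.Γ c = -(d.Γ a * d.Γ b * d.Γ c) := by
    rw [d.Γ_mul_Γ_of_ne hab.symm, neg_mul]
  have h₃ : d.Γ b * d.Γ c * d.Γ a = d.Γ a * d.Γ b * d.Γ c := by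
    rw [mul_assoc, d.Γ_mul_Γ_of_ne hac.symm, mul_neg, ← mul_assoc, h₂, neg_neg]
  have h₄ : d.Γ c * d.Γ a * d.Γ b = d.Γ a * d.Γ b * d.Γ c := by
    rw [d.Γ_mul_Γ_of_ne hac.symm, neg_mul, h₁, neg_neg]
  have h₅ : d.Γ c * d.Γ b * d.Γ a = -(d.Γ a * d.Γ b * d.Γ c) := by
    rw [d.Γ_mul_Γ_of_ne hbc.symm, neg_mul, h₃]
  rw [Γ3, h₁, h₂, h₃, h₄, h₅]
  module

/-- Duality of `ω` in components: if `Γ_a Γ_b Γ_c Γ_x Γ_y Γ_z` acts on `s^B` by a scalar, then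
`ω_{abc}` and `ω_{xyz}` are proportional. -/
theorem omega3_dual {s : Fin 2 → Spinor8} {A B : Fin 2} {a b c x y z : Fin 6}
    (h : [a, b, c, x, y, z].Nodup) {k : ℂ}
    (hk : (([a, b, c, x, y, z].map d.Γ).prod).mulVec (s B) = k • s B) :
    k * d.omega3 s A B a b c = -((ηd a : ℂ) * ηd b * ηd c) * d.omega3 s A B x y z := by
  simp only [List.nodup_cons, List.mem_cons, List.not_mem_nil, not_or, or_false] at h
  obtain ⟨⟨hab, hac, -, -, -⟩, ⟨hbc, -, -, -⟩, -, ⟨hxy, hxz⟩, hyz, -⟩ := h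
  have h := congrArg (d.Γ a * d.Γ b * d.Γ c).mulVec hk
  have hprod : ([a, b, c, x, y, z].map d.Γ).prod =
      d.Γ a * d.Γ b * d.Γ c * (d.Γ x * d.Γ y * d.Γ z) := by simp [mul_assoc]
  rw [hprod, mulVec_mulVec, ← mul_assoc, d.Γ_triple_sq hab hac hbc, smul_mul_assoc, one_mul,
    mulVec_smul, smul_mulVec, ← d.Γ3_of_ne hab hac hbc, ← d.Γ3_of_ne hxy hxz hyz] at h
  have h' := congrArg (d.bar (s A)) h
  rw [map_smul, map_smul, smul_eq_mul, smul_eq_mul] at h'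
  exact h'.symm

theorem perm_of_nodup {l : List (Fin 6)} (h : l.Nodup) (hl : l.length = 6) :
    l.Perm [0, 1, 2, 3, 4, 5] := by
  refine (List.perm_ext_iff_of_nodup h (by decide)).mpr fun i => ?_
  have hu : l.toFinset = Finset.univ := by
    rw [← Finset.card_eq_iff_eq_univ, List.toFinset_card_of_nodup h, hl, Fintype.card_fin]
  have h₁ : i ∈ l := by rw [← List.mem_toFinset, hu]; exact Finset.mem_univ i
  have h₂ : i ∈ ([0, 1, 2, 3, 4, 5] : List (Fin 6)) := by clear h₁; revert i; decide
  exact iff_of_true h₁ h₂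

/-- The remaining two indices after four distinct ones. -/
theorem exists_complement {μ ν ρ σ : Fin 6} (h : [μ, ν, ρ, σ].Nodup) :
    ∃ τ υ : Fin 6, [μ, ν, ρ, σ, τ, υ].Nodup := by
  have hc : (([μ, ν, ρ, σ].toFinset)ᶜ).card = 2 := by
    rw [Finset.card_compl, List.toFinset_card_of_nodup h]
    simp
  obtain ⟨τ, υ, hne, he⟩ := Finset.card_eq_two.mp hc
  have hτ : τ ∈ ([μ, ν, ρ, σ].toFinset)ᶜ := by rw [he]; simp
  have hυ : υ ∈ ([μ, ν, ρ, σ].toFinset)ᶜ := by rw [he]; simp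
  refine ⟨τ, υ, ?_⟩
  simp only [Finset.mem_compl, List.mem_toFinset] at hτ hυ
  change ([μ, ν, ρ, σ] ++ [τ, υ]).Nodup
  rw [List.nodup_append]
  refine ⟨h, by simpa using hne, ?_⟩
  rintro i hi j hj rfl
  simp only [List.mem_cons, List.not_mem_nil, or_false] at hj
  rcases hj with rfl | rfl
  · exact hτ hi
  · exact hυ hi

theorem wedge_of_nodup {s : Fin 2 → Spinor8} (hs : ∀ A, d.Pos (s A)) (A B : Fin 2)
    {μ ν ρ σ : Fin 6} (h : [μ, ν, ρ, σ].Nodup) :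
    (ηd μ : ℂ) * d.kappa s μ * d.omega3 s A B ν ρ σ
      - (ηd ν : ℂ) * d.kappa s ν * d.omega3 s A B μ ρ σ
      + (ηd ρ : ℂ) * d.kappa s ρ * d.omega3 s A B μ ν σ
      - (ηd σ : ℂ) * d.kappa s σ * d.omega3 s A B μ ν ρ = 0 := by
  obtain ⟨τ, υ, hn⟩ := exists_complement h
  have hperm := perm_of_nodup hn rfl
  obtain ⟨k, hk, hprod⟩ := d.exists_sign_prod_of_perm hperm hn
  have hact : (([μ, ν, ρ, σ, τ, υ].map d.Γ).prod).mulVec (s B) = k • s B := by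
    rw [hprod, ← Γ7_eq_prod, smul_mulVec, hs B]
  have hsum := d.sum_kappa_mul_omega3 hs A B τ υ
  have hlist : ∑ i, d.kappa s i * d.omega3 s A B i τ υ =
      ([μ, ν, ρ, σ, τ, υ].map fun i => d.kappa s i * d.omega3 s A B i τ υ).sum := by
    rw [(hperm.map _).sum_eq, Fin.sum_univ_six]
    simp [add_assoc]
  rw [hlist] at hsum
  simp only [List.map_cons, List.sum_cons, List.map_nil, List.sum_nil, omega3_self_left,
    omega3_self_outer, mul_zero, add_zero] at hsum
  have hn' := hn
  simp only [List.nodup_cons, List.mem_cons, List.not_mem_nil, not_or, or_false, ← ne_eq] at hn'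
  obtain ⟨⟨hμν, hμρ, hμσ, -, -⟩, ⟨hνρ, hνσ, -, -⟩, ⟨hρσ, -, -⟩, -⟩ := hn'
  have e₄ := d.omega3_dual (A := A) hn hact
  have act₃ : (([μ, ν, σ, ρ, τ, υ].map d.Γ).prod).mulVec (s B) = (-k) • s B := by
    rw [neg_smul, ← hact, ← neg_mulVec]
    congr 1
    simp only [List.map_cons, List.prod_cons, ← mul_assoc]
    rw [mul_assoc _ (d.Γ σ) (d.Γ ρ), d.Γ_mul_Γ_of_ne hρσ.symm]
    simp only [mul_neg, neg_mul, mul_assoc]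
  have act₂ : (([μ, ρ, σ, ν, τ, υ].map d.Γ).prod).mulVec (s B) = k • s B := by
    rw [← hact]
    congr 1
    have := d.Γ_mul_prod ν [ρ, σ]
    simp [hνρ.symm, hνσ.symm] at this
    simp only [List.map_cons, List.prod_cons, ← mul_assoc]
    rw [mul_assoc _ (d.Γ ν) (d.Γ ρ), mul_assoc _ (d.Γ ν * d.Γ ρ), mul_assoc (d.Γ ν), this]
    simp only [mul_assoc]
  have act₁ : (([ν, ρ, σ, μ, τ, υ].map d.Γ).prod).mulVec (s B) = (-k) • s B := by
    rw [neg_smul, ← hact, ← neg_mulVec]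
    congr 1
    have := d.Γ_mul_prod μ [ν, ρ, σ]
    simp [hμν.symm, hμρ.symm, hμσ.symm, pow_succ] at this
    simp only [List.map_cons, List.prod_cons, ← mul_assoc]
    rw [mul_assoc (d.Γ μ) (d.Γ ν) (d.Γ ρ), mul_assoc (d.Γ μ) (d.Γ ν * d.Γ ρ),
      mul_assoc (d.Γ ν), this]
    simp only [neg_mul, neg_neg, mul_assoc]
  have e₃ := d.omega3_dual (A := A) (by grind) act₃
  have e₂ := d.omega3_dual (A := A) (by grind) act₂
  have e₁ := d.omega3_dual (A := A) (by grind) act₁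
  have hk0 : k ≠ 0 := by
    rintro rfl
    simp at hk
  apply (mul_eq_zero.mp _).resolve_left hk0
  linear_combination -(ηd μ : ℂ) * d.kappa s μ * e₁ - (ηd ν : ℂ) * d.kappa s ν * e₂
    - (ηd ρ : ℂ) * d.kappa s ρ * e₃ - (ηd σ : ℂ) * d.kappa s σ * e₄
    + (ηd μ : ℂ) * ηd ν * ηd ρ * ηd σ * hsum

end CliffordData

/-- Let `κ` and `ω^{AB}` be the Dirac current and 3-forms
associated to `s ∈ S`.  Then (i) `ι_κ ω^{AB} = 0`, i.e. `κ^μ ω_{μνρ}{}^{AB} = 0`,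
and (ii) `κ♭ ∧ ω^{AB} = 0`, i.e. the alternation of `κ_μ ω_{νρσ}{}^{AB}`
vanishes, for all `A, B`. -/
theorem iota_kappa_omega_and_wedge_vanish (d : CliffordData)
    (s : Fin 2 → Spinor8) (hs : d.IsS s) :
    (∀ A B ν ρ, ∑ μ, d.kappa s μ * d.omega3 s A B μ ν ρ = 0) ∧
    (∀ A B μ ν ρ σ,
       (ηd μ : ℂ) * d.kappa s μ * d.omega3 s A B ν ρ σ
       - (ηd ν : ℂ) * d.kappa s ν * d.omega3 s A B μ ρ σ
       + (ηd ρ : ℂ) * d.kappa s ρ * d.omega3 s A B μ ν σ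
       - (ηd σ : ℂ) * d.kappa s σ * d.omega3 s A B μ ν ρ = 0) := by
  refine ⟨d.sum_kappa_mul_omega3 hs.1, fun A B μ ν ρ σ => ?_⟩
  by_cases h : [μ, ν, ρ, σ].Nodup
  · exact d.wedge_of_nodup hs.1 A B h
  · simp only [List.nodup_cons, List.mem_cons, List.not_mem_nil, not_or, or_false,
      not_false_eq_true, List.nodup_nil, and_true] at h
    have h' : μ = ν ∨ μ = ρ ∨ μ = σ ∨ ν = ρ ∨ ν = σ ∨ ρ = σ := by tauto
    rcases h' with rfl | rfl | rfl | rfl | rfl | rfl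
    · simp [d.omega3_self_left]
    · simp only [d.omega3_self_outer, d.omega3_swap_left s A B μ ν σ, d.omega3_self_left]
      ring
    · rw [d.omega3_self_outer, d.omega3_self_outer, d.omega3_swap_right s A B ν μ ρ,
        d.omega3_swap_left s A B μ ν ρ]
      ring
    · simp [d.omega3_self_left, d.omega3_self_right]
    · rw [d.omega3_self_outer, d.omega3_self_right, d.omega3_swap_right s A B μ ν ρ]
      ring
    · simp [d.omega3_self_right]
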